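/- arXiv:1606.06229 — 9 statements merged into one kernel-verified Lean document; each statement's English description precedes it below -/
import Mathlib

section
/- For all real t, x and all real λ, the series Σ_{j=0}^∞ v_j(t,x)·(iλ)^j/j! converges absolutely in ℂ and its sum equals exp(iλx − λ²t/2). (This is the generating-function identity (2.1) of the paper, with the recursively defined heat polynomials v_j.) -/
/-- The heat polynomials `v_j : ℝ × ℝ → ℝ` defined recursively by
`v_0(t,x) = 1`, `v_1(t,x) = x`, and `v_{j+1}(t,x) = x·v_j(t,x) + j·t·v_{j-1}(t,x)` for `j ≥ 1`. -/
noncomputable def v : ℕ → ℝ → ℝ → ℝ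
  | 0, _, _ => 1
  | 1, _, x => x
  | (j + 2), t, x => x * v (j + 1) t x + (j + 1 : ℝ) * t * v j t x

lemma heat_iter (t x : ℂ) (f : ℂ → ℂ) (hf : ContDiff ℂ ⊤ f)
    (h1 : ∀ z, deriv f z = (x + z * t) * f z) (n : ℕ) : ∀ z : ℂ,
    iteratedDeriv (n + 2) f z =
      (x + z * t) * iteratedDeriv (n + 1) f z + (n + 1) * t * iteratedDeriv n f z := by
  have hd : ∀ m z, HasDerivAt (iteratedDeriv m f) (iteratedDeriv (m + 1) f z) z := by
    intro m z
    rw [iteratedDeriv_succ]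
    exact ((hf.differentiable_iteratedDeriv m (by exact WithTop.coe_lt_top _)) z).hasDerivAt
  have hl : ∀ z : ℂ, HasDerivAt (fun z : ℂ => x + z * t) t z := by
    intro z
    simpa using ((hasDerivAt_id z).mul_const t).const_add x
  induction n with
  | zero =>
    intro z
    have e : iteratedDeriv (0 + 1) f = fun z => (x + z * t) * iteratedDeriv 0 f z := by
      funext z
      simp [iteratedDeriv_one, h1]
    have h2 := hd (0 + 1) z
    have h3 := (hl z).mul (hd 0 z)
    have h4 := h3.congr_of_eventuallyEq (Filter.EventuallyEq.of_eq e)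
    rw [h2.unique h4]
    push_cast
    ring
  | succ n ih =>
    intro z
    have h2 := hd (n + 2) z
    have h3 := ((hl z).mul (hd (n + 1) z)).add ((hd n z).const_mul (((n : ℂ) + 1) * t))
    have h4 := h3.congr_of_eventuallyEq (Filter.EventuallyEq.of_eq (funext ih))
    rw [show n + 1 + 2 = n + 2 + 1 from rfl, h2.unique h4]
    push_cast
    ring

lemma heat_coeff (t x : ℝ) (f : ℂ → ℂ) (hf : ContDiff ℂ ⊤ f) (h0 : f 0 = 1)
    (h1 : ∀ z, deriv f z = ((x : ℂ) + z * t) * f z) (n : ℕ) :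
    iteratedDeriv n f 0 = (v n t x : ℂ) ∧ iteratedDeriv (n + 1) f 0 = (v (n + 1) t x : ℂ) := by
  induction n with
  | zero => simp [iteratedDeriv_one, h1, h0, v]
  | succ n ih =>
    refine ⟨ih.2, ?_⟩
    rw [heat_iter t x f hf h1 n 0, ih.1, ih.2]
    simp [v]

/-- Generating-function identity: for all real `t, x, λ`, the series
`Σ_{j=0}^∞ v_j(t,x)·(iλ)^j/j!` converges absolutely in `ℂ` and sums to
`exp(iλx − λ²t/2)`. -/
theorem generating_function_identity (t x l : ℝ) :
    Summable (fun j : ℕ =>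
      ‖((v j t x : ℂ) * (Complex.I * (l : ℂ)) ^ j / (Nat.factorial j : ℂ))‖) ∧
    HasSum (fun j : ℕ =>
      (v j t x : ℂ) * (Complex.I * (l : ℂ)) ^ j / (Nat.factorial j : ℂ))
      (Complex.exp (Complex.I * (l : ℂ) * (x : ℂ) - (l : ℂ) ^ 2 * (t : ℂ) / 2)) := by
  set f : ℂ → ℂ := fun z => Complex.exp (z * x + z ^ 2 * t / 2) with hfdef
  have hf : ContDiff ℂ ⊤ f := by fun_prop
  have h1 : ∀ z, deriv f z = ((x : ℂ) + z * t) * f z := by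
    intro z
    have : HasDerivAt (fun z : ℂ => z * x + z ^ 2 * t / 2) ((x : ℂ) + z * t) z := by
      have := ((hasDerivAt_id z).mul_const (x : ℂ)).add
        ((((hasDerivAt_id z).pow 2).mul_const (t : ℂ)).div_const 2)
      refine this.congr_deriv ?_
      simp
      ring
    rw [this.cexp.deriv]
    ring
  have key : HasSum (fun j : ℕ =>
      (v j t x : ℂ) * (Complex.I * (l : ℂ)) ^ j / (Nat.factorial j : ℂ))
      (Complex.exp (Complex.I * (l : ℂ) * (x : ℂ) - (l : ℂ) ^ 2 * (t : ℂ) / 2)) := by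
    have h := Complex.hasSum_taylorSeries_of_entire (hf.differentiable (by simp)) 0
      (Complex.I * (l : ℂ))
    have e : f (Complex.I * (l : ℂ)) =
        Complex.exp (Complex.I * (l : ℂ) * (x : ℂ) - (l : ℂ) ^ 2 * (t : ℂ) / 2) := by
      simp only [hfdef, mul_pow, Complex.I_sq]
      congr 1
      ring
    rw [e] at h
    refine h.congr_fun ?_
    intro j
    rw [(heat_coeff t x f hf (by simp [hfdef]) h1 j).1]
    simp only [smul_eq_mul, sub_zero]
    ring
  exact ⟨key.summable.norm, key⟩
end

section
/- (Lemma 1, derivative formula.) For every p ∈ ℕ and all real t, x, the p-th derivative with respect to λ ∈ ℝ of the function λ ↦ exp(iλx − λ²t/2) equals v_p(−t, ix − λt)·exp(iλx − λ²t/2), where v_p is evaluated at the complex arguments (−t, ix − λt). -/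
/-- The heat polynomials extended to complex arguments, defined recursively by
`v_0(t,x) = 1`, `v_1(t,x) = x`, and `v_{j+1}(t,x) = x·v_j(t,x) + j·t·v_{j-1}(t,x)` for `j ≥ 1`. -/
noncomputable def vC : ℕ → ℂ → ℂ → ℂ
  | 0, _, _ => 1
  | 1, _, x => x
  | (j + 2), t, x => x * vC (j + 1) t x + (j + 1 : ℂ) * t * vC j t x

theorem vC_step (s y : ℂ) (j : ℕ) :
    vC (j + 1) s y = y * vC j s y + (j : ℂ) * s * vC (j - 1) s y := by
  cases j with
  | zero => simp [vC]
  | succ k => simp [vC]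

theorem vC_hasDerivAt (s y : ℂ) (j : ℕ) :
    HasDerivAt (fun z => vC j s z) ((j : ℂ) * vC (j - 1) s y) y ∧
    HasDerivAt (fun z => vC (j + 1) s z) (((j : ℂ) + 1) * vC j s y) y := by
  induction j with
  | zero =>
    constructor
    · simpa [vC] using hasDerivAt_const y (1 : ℂ)
    · simpa [vC] using hasDerivAt_id' y
  | succ k ih =>
    obtain ⟨h0, h1⟩ := ih
    refine ⟨by simpa using h1, ?_⟩
    have h := ((hasDerivAt_id y).mul h1).add (h0.const_mul (((k : ℂ) + 1) * s))
    have e : (fun z => vC (k + 1 + 1) s z) =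
        (id * fun z => vC (k + 1) s z) + fun z => ((k : ℂ) + 1) * s * vC k s z := by
      funext z
      simp [vC]
    rw [e]
    refine h.congr_deriv ?_
    have := vC_step s y k
    simp only [id, Nat.cast_add, Nat.cast_one]
    linear_combination (-((k : ℂ) + 1)) * this

/-- Lemma 1 (derivative formula): for every `p ∈ ℕ` and all real `t, x`, the `p`-th
derivative in `λ ∈ ℝ` of `λ ↦ exp(iλx − λ²t/2)` equals
`v_p(−t, ix − λt)·exp(iλx − λ²t/2)`, with `v_p` evaluated at complex arguments. -/
theorem iteratedDeriv_gaussian_exp (p : ℕ) (t x : ℝ) (l : ℝ) :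
    iteratedDeriv p
        (fun l' : ℝ => Complex.exp (Complex.I * (l' : ℂ) * (x : ℂ) - (l' : ℂ) ^ 2 * (t : ℂ) / 2)) l
      = vC p (-(t : ℂ)) (Complex.I * (x : ℂ) - (l : ℂ) * (t : ℂ)) *
          Complex.exp (Complex.I * (l : ℂ) * (x : ℂ) - (l : ℂ) ^ 2 * (t : ℂ) / 2) := by
  induction p generalizing l with
  | zero => simp [vC]
  | succ p ih =>
    rw [iteratedDeriv_succ, funext ih]
    have hl : HasDerivAt (fun r : ℝ => (r : ℂ)) 1 l := Complex.ofRealCLM.hasDerivAt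
    have hy : HasDerivAt (fun r : ℝ => Complex.I * (x : ℂ) - (r : ℂ) * (t : ℂ)) (-(t : ℂ)) l := by
      simpa using (hl.mul_const (t : ℂ)).const_sub (Complex.I * (x : ℂ))
    have he : HasDerivAt
        (fun r : ℝ => Complex.I * (r : ℂ) * (x : ℂ) - (r : ℂ) ^ 2 * (t : ℂ) / 2)
        (Complex.I * (x : ℂ) - (l : ℂ) * (t : ℂ)) l := by
      refine (((hl.const_mul Complex.I).mul_const (x : ℂ)).sub
        (((hl.pow 2).mul_const (t : ℂ)).div_const 2)).congr_deriv ?_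
      push_cast
      ring
    have hv := (vC_hasDerivAt (-(t : ℂ)) (Complex.I * (x : ℂ) - (l : ℂ) * (t : ℂ)) p).1.comp l hy
    refine (hv.mul he.cexp).deriv.trans ?_
    rw [vC_step]
    simp only [Function.comp]
    ring
end

section
/- (Identity (3.1) in the proof of Theorem 2.) Let d₀, d₁, c₀, c₁, c₂ ∈ ℝ and let φ : ℝ → ℂ be a Schwartz function satisfying φ''(x) = (d₀ + d₁x)·φ'(x) + (c₀ + c₁x + c₂x²)·φ(x) for all x ∈ ℝ. Let φ̄ be its Fourier transform and set ν(t,x) := (1/(2π)) ∫_ℝ φ̄(λ) e^{iλx − λ²t/2} dλ. Then for all t > 0 and x ∈ ℝ: (1 − d₁t − c₂t²)·∂²_x ν(t,x) = (d₀ + d₁x + c₁t + 2c₂tx)·∂_x ν(t,x) + (c₀ + c₁x + c₂x² + c₂t)·ν(t,x). -/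
open MeasureTheory

/-- The Fourier transform `φ̄(λ) = ∫_ℝ φ(x) e^{−iλx} dx` of an integrable `φ : ℝ → ℂ`. -/
noncomputable def fourierT (φ : ℝ → ℂ) (l : ℝ) : ℂ :=
  ∫ x : ℝ, φ x * Complex.exp (-(Complex.I * (l : ℂ) * (x : ℂ)))

/-- `ν(t,x) := (1/(2π)) ∫_ℝ φ̄(λ) e^{iλx − λ²t/2} dλ`. -/
noncomputable def nu (φb : ℝ → ℂ) (t x : ℝ) : ℂ :=
  (1 / (2 * (Real.pi : ℂ))) *
    ∫ l : ℝ, φb l * Complex.exp (Complex.I * (l : ℂ) * (x : ℂ) - (l : ℂ) ^ 2 * (t : ℂ) / 2)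

open scoped FourierTransform SchwartzMap

/-- multiplication by the variable on Schwartz functions -/
noncomputable def mulX (f : 𝓢(ℝ, ℂ)) : 𝓢(ℝ, ℂ) :=
  SchwartzMap.smulLeftCLM ℂ (fun x : ℝ => x) f

/-- derivative of Schwartz functions -/
noncomputable def dS (f : 𝓢(ℝ, ℂ)) : 𝓢(ℝ, ℂ) := SchwartzMap.derivCLM ℝ ℂ f

lemma mulX_apply (f : 𝓢(ℝ, ℂ)) (x : ℝ) : mulX f x = (x : ℂ) * f x := by
  unfold mulX
  rw [SchwartzMap.smulLeftCLM_apply_apply (by fun_prop)]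
  simp

lemma dS_apply (f : 𝓢(ℝ, ℂ)) (x : ℝ) : dS f x = deriv f x := rfl

lemma fourierT_eq (f : ℝ → ℂ) (l : ℝ) : fourierT f l = 𝓕 f (l / (2 * Real.pi)) := by
  rw [Real.fourier_real_eq_integral_exp_smul, fourierT]
  congr 1 with x
  rw [smul_eq_mul, mul_comm]
  congr 2
  push_cast
  have : (Real.pi : ℂ) ≠ 0 := by exact_mod_cast Real.pi_ne_zero
  field_simp

lemma fourierT_integrable (f : 𝓢(ℝ, ℂ)) : Integrable (fourierT f) := by
  have h : Integrable (𝓕 (f : ℝ → ℂ)) := by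
    rw [← SchwartzMap.fourier_coe]; exact SchwartzMap.integrable _
  have := h.comp_div (R := 2 * Real.pi) (by positivity)
  refine this.congr (Filter.Eventually.of_forall fun l => ?_)
  exact (fourierT_eq f l).symm

lemma mulX_integrable (f : 𝓢(ℝ, ℂ)) : Integrable (fun x : ℝ => x • f x) := by
  refine (mulX f).integrable.congr (Filter.Eventually.of_forall fun l => ?_)
  simp [mulX_apply]

lemma fourierT_dS (f : 𝓢(ℝ, ℂ)) (l : ℝ) :
    fourierT (dS f) l = Complex.I * l * fourierT f l := by
  rw [fourierT_eq, fourierT_eq]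
  have h1 : (⇑(dS f)) = deriv f := rfl
  have h2 := (dS f).integrable (μ := volume)
  rw [h1] at h2 ⊢
  rw [Real.fourier_deriv f.integrable f.differentiable h2]
  have : (Real.pi : ℂ) ≠ 0 := by exact_mod_cast Real.pi_ne_zero
  simp only [smul_eq_mul]
  congr 1
  push_cast
  field_simp

lemma fourierT_hasDerivAt (f : 𝓢(ℝ, ℂ)) (l : ℝ) :
    HasDerivAt (fourierT f) (-Complex.I * fourierT (mulX f) l) l := by
  have h := Real.hasDerivAt_fourier f.integrable (mulX_integrable f) (l / (2 * Real.pi))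
  have h2 : HasDerivAt (fun l : ℝ => l / (2 * Real.pi)) (1 / (2 * Real.pi)) l :=
    (hasDerivAt_id l).div_const _
  have h3 := h.scomp l h2
  have e : fourierT f = (𝓕 (f : ℝ → ℂ)) ∘ fun l : ℝ => l / (2 * Real.pi) := by
    ext l; exact fourierT_eq f l
  rw [e]
  refine h3.congr_deriv (Eq.symm ?_)
  have hp : (Real.pi : ℂ) ≠ 0 := by exact_mod_cast Real.pi_ne_zero
  have e2 : (fun x : ℝ => (-2 * Real.pi * Complex.I * x : ℂ) • f x)
      = (-2 * Real.pi * Complex.I : ℂ) • (⇑(mulX f)) := by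
    ext x; simp [mulX_apply]; ring
  rw [e2, fourierT_eq, Real.fourier_real_eq_integral_exp_smul,
    Real.fourier_real_eq_integral_exp_smul]
  simp only [Pi.smul_apply, smul_eq_mul, mul_left_comm _ (-2 * Real.pi * Complex.I : ℂ) _,
    integral_const_mul, Complex.real_smul]
  push_cast
  field_simp
  simp only [mul_right_comm Complex.I _ (l : ℂ)]

/-- the Gaussian-damped character -/
noncomputable def ker (t x l : ℝ) : ℂ :=
  Complex.exp (Complex.I * (l : ℂ) * (x : ℂ) - (l : ℂ) ^ 2 * (t : ℂ) / 2)

lemma norm_ker_le (t x l : ℝ) (ht : 0 < t) : ‖ker t x l‖ ≤ 1 := by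
  rw [ker, Complex.norm_exp]
  have : (Complex.I * (l : ℂ) * (x : ℂ) - (l : ℂ) ^ 2 * (t : ℂ) / 2).re = - (l ^ 2 * t / 2) := by
    have : (Complex.I * (l : ℂ) * (x : ℂ) - (l : ℂ) ^ 2 * (t : ℂ) / 2)
      = ((- (l ^ 2 * t / 2) : ℝ) : ℂ) + ((l * x : ℝ) : ℂ) * Complex.I := by
      push_cast; ring
    rw [this, Complex.add_re, Complex.re_ofReal_mul, Complex.I_re, mul_zero, add_zero,
      Complex.ofReal_re]
  rw [this, Real.exp_le_one_iff]
  have : 0 ≤ l ^ 2 * t / 2 := by positivity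
  linarith

lemma ker_cont (t x : ℝ) : Continuous (ker t x) := by unfold ker; fun_prop

lemma int_ker (g : ℝ → ℂ) (hg : Integrable g) (t x : ℝ) (ht : 0 < t) :
    Integrable (fun l => g l * ker t x l) :=
  hg.mul_bdd (c := 1) (ker_cont t x).aestronglyMeasurable
    (Filter.Eventually.of_forall fun l => norm_ker_le t x l ht)

/-- heat evolution -/
noncomputable def P (t x : ℝ) (f : 𝓢(ℝ, ℂ)) : ℂ := nu (fourierT f) t x

lemma P_def (t x : ℝ) (f : 𝓢(ℝ, ℂ)) :
    P t x f = (1 / (2 * (Real.pi : ℂ))) * ∫ l : ℝ, fourierT f l * ker t x l := rfl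

lemma fourierT_int (f : 𝓢(ℝ, ℂ)) (l : ℝ) :
    Integrable (fun x : ℝ => f x * Complex.exp (-(Complex.I * (l : ℂ) * (x : ℂ)))) := by
  refine f.integrable.mul_bdd (c := 1) (by fun_prop) (Filter.Eventually.of_forall fun x => ?_)
  rw [Complex.norm_exp]; simp

lemma P_add (t x : ℝ) (ht : 0 < t) (f g : 𝓢(ℝ, ℂ)) : P t x (f + g) = P t x f + P t x g := by
  have h : ∀ l, fourierT (⇑(f + g)) l = fourierT f l + fourierT g l := by
    intro l
    unfold fourierT
    rw [← integral_add (fourierT_int f l) (fourierT_int g l)]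
    congr 1 with x
    simp [add_mul]
  simp only [P_def, h, add_mul]
  rw [integral_add (int_ker _ (fourierT_integrable f) t x ht)
    (int_ker _ (fourierT_integrable g) t x ht)]
  ring

lemma P_smul (t x : ℝ) (c : ℂ) (f : 𝓢(ℝ, ℂ)) : P t x (c • f) = c * P t x f := by
  have h : ∀ l, fourierT (⇑(c • f)) l = c * fourierT f l := by
    intro l
    unfold fourierT
    rw [← integral_const_mul]
    congr 1 with x
    simp [mul_assoc]
  simp only [P_def, h, mul_assoc, integral_const_mul]
  ring

lemma P_hasDerivAt (t x : ℝ) (ht : 0 < t) (f : 𝓢(ℝ, ℂ)) :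
    HasDerivAt (fun y => P t y f) (P t x (dS f)) x := by
  simp only [P_def]
  refine HasDerivAt.const_mul _ ?_
  refine (hasDerivAt_integral_of_dominated_loc_of_deriv_le (s := Set.univ)
    (F := fun y l => fourierT f l * ker t y l)
    (F' := fun y l => fourierT (dS f) l * ker t y l)
    (bound := fun l => ‖fourierT (dS f) l‖) Filter.univ_mem ?_ ?_ ?_ ?_ ?_ ?_).2
  · exact Filter.Eventually.of_forall fun y =>
      (int_ker _ (fourierT_integrable f) t y ht).aestronglyMeasurable
  · exact int_ker _ (fourierT_integrable f) t x ht
  · exact (int_ker _ (fourierT_integrable (dS f)) t x ht).aestronglyMeasurable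
  · refine Filter.Eventually.of_forall fun l y _ => ?_
    rw [norm_mul]
    exact mul_le_of_le_one_right (norm_nonneg _) (norm_ker_le t y l ht)
  · exact (fourierT_integrable (dS f)).norm
  · refine Filter.Eventually.of_forall fun l y _ => ?_
    have h : HasDerivAt (fun y : ℝ => Complex.I * (l : ℂ) * (y : ℂ) - (l : ℂ) ^ 2 * (t : ℂ) / 2)
        (Complex.I * l * 1) y :=
      ((Complex.ofRealCLM.hasDerivAt (x := y)).const_mul _).sub_const _
    have h2 := h.cexp.const_mul (fourierT f l)
    refine h2.congr_deriv ?_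
    rw [fourierT_dS, ker]; ring

lemma ker_hasDerivAt (t x l : ℝ) :
    HasDerivAt (ker t x) ((Complex.I * x - l * t) * ker t x l) l := by
  have h0 : HasDerivAt (fun l : ℝ => (l : ℂ)) 1 l := Complex.ofRealCLM.hasDerivAt (x := l)
  have h : HasDerivAt (fun l : ℝ => Complex.I * (l : ℂ) * (x : ℂ) - (l : ℂ) ^ 2 * (t : ℂ) / 2)
      _ l := ((h0.const_mul Complex.I).mul_const (x : ℂ)).sub
        (((h0.pow 2).mul_const (t : ℂ)).div_const 2)
  refine h.cexp.congr_deriv ?_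
  rw [ker]; push_cast; ring

lemma P_mulX (t x : ℝ) (ht : 0 < t) (f : 𝓢(ℝ, ℂ)) :
    P t x (mulX f) = x * P t x f + t * P t x (dS f) := by
  have i1 := int_ker _ (fourierT_integrable f) t x ht
  have i2 := int_ker _ (fourierT_integrable (dS f)) t x ht
  have i3 := int_ker _ (fourierT_integrable (mulX f)) t x ht
  have e : ∀ l, fourierT f l * ((Complex.I * x - l * t) * ker t x l)
      = Complex.I * x * (fourierT f l * ker t x l)
        + Complex.I * t * (fourierT (dS f) l * ker t x l) := by
    intro l
    rw [fourierT_dS]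
    linear_combination (-(l * t * fourierT f l * ker t x l)) * Complex.I_mul_I
  have e3 : ∀ l, (-Complex.I * fourierT (mulX f) l) * ker t x l
      = -Complex.I * (fourierT (mulX f) l * ker t x l) := fun l => by ring
  have key := integral_mul_deriv_eq_deriv_mul_of_integrable
    (u := fourierT f) (v := ker t x) (u' := fun l => -Complex.I * fourierT (mulX f) l)
    (v' := fun l => (Complex.I * x - l * t) * ker t x l)
    (fun l _ => fourierT_hasDerivAt f l) (fun l _ => ker_hasDerivAt t x l)
    (((i1.const_mul _).add (i2.const_mul _)).congr
      (Filter.Eventually.of_forall fun l => (e l).symm))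
    ((i3.const_mul _).congr (Filter.Eventually.of_forall fun l => (e3 l).symm)) i1
  simp only [e, e3] at key
  rw [integral_add (i1.const_mul _) (i2.const_mul _)] at key
  simp only [integral_const_mul] at key
  simp only [P_def]
  have := mul_left_cancel₀ Complex.I_ne_zero (a := Complex.I)
    (b := ∫ l, fourierT (mulX f) l * ker t x l)
    (c := x * (∫ l, fourierT f l * ker t x l) + t * ∫ l, fourierT (dS f) l * ker t x l)
    (by linear_combination -key)
  rw [this]; ring

lemma dS_mulX (f : 𝓢(ℝ, ℂ)) : dS (mulX f) = f + mulX (dS f) := by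
  ext x
  have e : (⇑(mulX f)) = fun x : ℝ => (x : ℂ) * f x := by ext x; exact mulX_apply f x
  rw [dS_apply, e]
  have h := (Complex.ofRealCLM.hasDerivAt (x := x)).mul (f.differentiableAt (x := x)).hasDerivAt
  refine h.deriv.trans ?_
  simp [mulX_apply, dS_apply]

/-- Identity (3.1): if the Schwartz function `φ` satisfies
`φ'' = (d₀ + d₁x)·φ' + (c₀ + c₁x + c₂x²)·φ`, then `ν` built from its Fourier transform
satisfies, for all `t > 0` and `x ∈ ℝ`,
`(1 − d₁t − c₂t²)·∂²_x ν = (d₀ + d₁x + c₁t + 2c₂tx)·∂_x ν + (c₀ + c₁x + c₂x² + c₂t)·ν`. -/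
theorem identity_3_1 (d0 d1 c0 c1 c2 : ℝ) (φ : SchwartzMap ℝ ℂ)
    (hODE : ∀ x : ℝ, deriv (deriv (⇑φ)) x
      = ((d0 + d1 * x : ℝ) : ℂ) * deriv (⇑φ) x + ((c0 + c1 * x + c2 * x ^ 2 : ℝ) : ℂ) * φ x) :
    ∀ t : ℝ, 0 < t → ∀ x : ℝ,
      ((1 - d1 * t - c2 * t ^ 2 : ℝ) : ℂ) *
          iteratedDeriv 2 (fun y : ℝ => nu (fourierT (⇑φ)) t y) x
        = ((d0 + d1 * x + c1 * t + 2 * c2 * t * x : ℝ) : ℂ) *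
            deriv (fun y : ℝ => nu (fourierT (⇑φ)) t y) x
          + ((c0 + c1 * x + c2 * x ^ 2 + c2 * t : ℝ) : ℂ) * nu (fourierT (⇑φ)) t x := by
  intro t ht x
  have D1 : deriv (fun y : ℝ => nu (fourierT (⇑φ)) t y) = fun y => P t y (dS φ) := by
    ext y; exact (P_hasDerivAt t y ht φ).deriv
  have D2 : iteratedDeriv 2 (fun y : ℝ => nu (fourierT (⇑φ)) t y) x = P t x (dS (dS φ)) := by
    rw [iteratedDeriv_succ, iteratedDeriv_one, D1]
    exact (P_hasDerivAt t x ht (dS φ)).deriv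
  have hS : dS (dS φ) = (d0 : ℂ) • dS φ + (d1 : ℂ) • mulX (dS φ) + (c0 : ℂ) • φ
      + (c1 : ℂ) • mulX φ + (c2 : ℂ) • mulX (mulX φ) := by
    ext y
    have h := hODE y
    have h' : dS (dS φ) y = deriv (deriv (⇑φ)) y := rfl
    rw [h', h]
    simp [mulX_apply, dS_apply]
    ring
  have hP := congrArg (P t x) hS
  simp only [P_add t x ht, P_smul, P_mulX t x ht, dS_mulX] at hP
  rw [D2, D1]
  change _ = _ + _ * P t x φ
  push_cast
  linear_combination hP
end

section
/- (Boundary ODE of Theorem 2.) Let d₀, d₁, c₀, c₁, c₂ ∈ ℝ and let U = (0,∞) × ℝ. Suppose ν : ℝ × ℝ → ℝ is C² on U, satisfies the heat equation ∂_t ν = (1/2)·∂²_{xx} ν on U, and satisfies the identity (1 − d₁t − c₂t²)·∂²_x ν(t,x) = (d₀ + d₁x + c₁t + 2c₂tx)·∂_x ν(t,x) + (c₀ + c₁x + c₂x² + c₂t)·ν(t,x) for all (t,x) ∈ U. Let f : (0,∞) → ℝ be differentiable with ν(t, f(t)) = 0 and ∂_x ν(t, f(t)) ≠ 0 for all t >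 0. Then for all t > 0: −2 f'(t)·(1 − d₁t − c₂t²) = d₀ + c₁t + (d₁ + 2c₂t)·f(t). -/
/-- Boundary ODE of Theorem 2: if `ν` is `C²` on `U = (0,∞) × ℝ`, solves the heat
equation on `U`, satisfies the second-order identity
`(1 − d₁t − c₂t²)·∂²_x ν = (d₀ + d₁x + c₁t + 2c₂tx)·∂_x ν + (c₀ + c₁x + c₂x² + c₂t)·ν`
on `U`, and vanishes along a differentiable boundary `f` with `∂_x ν(t,f(t)) ≠ 0`, then
`−2f'(t)·(1 − d₁t − c₂t²) = d₀ + c₁t + (d₁ + 2c₂t)·f(t)` for all `t > 0`. -/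
theorem boundary_ode_theorem2 (d0 d1 c0 c1 c2 : ℝ) (ν : ℝ → ℝ → ℝ) (f : ℝ → ℝ)
    (hν : ContDiffOn ℝ 2 (fun p : ℝ × ℝ => ν p.1 p.2) (Set.Ioi (0 : ℝ) ×ˢ Set.univ))
    (hheat : ∀ t : ℝ, 0 < t → ∀ x : ℝ,
      deriv (fun s : ℝ => ν s x) t = (1 / 2) * iteratedDeriv 2 (fun y : ℝ => ν t y) x)
    (hid : ∀ t : ℝ, 0 < t → ∀ x : ℝ,
      (1 - d1 * t - c2 * t ^ 2) * iteratedDeriv 2 (fun y : ℝ => ν t y) x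
        = (d0 + d1 * x + c1 * t + 2 * c2 * t * x) * deriv (fun y : ℝ => ν t y) x
          + (c0 + c1 * x + c2 * x ^ 2 + c2 * t) * ν t x)
    (hf : ∀ t : ℝ, 0 < t → DifferentiableAt ℝ f t)
    (hzero : ∀ t : ℝ, 0 < t → ν t (f t) = 0)
    (hne : ∀ t : ℝ, 0 < t → deriv (fun y : ℝ => ν t y) (f t) ≠ 0) :
    ∀ t : ℝ, 0 < t →
      -2 * deriv f t * (1 - d1 * t - c2 * t ^ 2)
        = d0 + c1 * t + (d1 + 2 * c2 * t) * f t := by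
  intro t ht
  have hmem : (Set.Ioi (0 : ℝ) ×ˢ (Set.univ : Set ℝ)) ∈ nhds (t, f t) :=
    prod_mem_nhds (Ioi_mem_nhds ht) Filter.univ_mem
  have hd : DifferentiableAt ℝ (fun p : ℝ × ℝ => ν p.1 p.2) (t, f t) :=
    (hν.contDiffAt hmem).differentiableAt (by norm_num)
  obtain ⟨L, hL⟩ := hd
  have h1 : HasDerivAt (fun s : ℝ => ν s (f t)) (L (1, 0)) t :=
    HasFDerivAt.comp_hasDerivAt (f := fun s : ℝ => (s, f t)) t hL
      ((hasDerivAt_id t).prodMk (hasDerivAt_const t (f t)))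
  have h2 : HasDerivAt (fun y : ℝ => ν t y) (L (0, 1)) (f t) :=
    HasFDerivAt.comp_hasDerivAt (f := fun y : ℝ => (t, y)) (f t) hL
      ((hasDerivAt_const (f t) t).prodMk (hasDerivAt_id (f t)))
  have h3 : HasDerivAt (fun s : ℝ => ν s (f s)) (L (1, deriv f t)) t :=
    HasFDerivAt.comp_hasDerivAt (f := fun s : ℝ => (s, f s)) t hL
      ((hasDerivAt_id t).prodMk (hf t ht).hasDerivAt)
  have h4 : HasDerivAt (fun s : ℝ => ν s (f s)) 0 t := by
    refine (hasDerivAt_const t (0 : ℝ)).congr_of_eventuallyEq ?_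
    filter_upwards [Ioi_mem_nhds ht] with s hs using hzero s hs
  have h5 : L (1, deriv f t) = L (1, 0) + deriv f t * L (0, 1) := by
    have : ((1 : ℝ), deriv f t) = (1, 0) + deriv f t • ((0 : ℝ), (1 : ℝ)) := by simp
    rw [this, map_add, map_smul, smul_eq_mul]
  have h6 := h3.unique h4
  have e1 := hheat t ht (f t)
  have e2 := hid t ht (f t)
  have e3 := hne t ht
  rw [h1.deriv] at e1
  rw [h2.deriv, hzero t ht] at e2
  rw [h2.deriv] at e3
  apply mul_right_cancel₀ e3
  rw [h5] at h6
  linear_combination e2 + 2 * (1 - d1 * t - c2 * t ^ 2) * e1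
    - 2 * (1 - d1 * t - c2 * t ^ 2) * h6
end

section
/- (Theorem 2, solution formula.) Let d₀, d₁, c₀ (unused), c₁, c₂, 𝒞 ∈ ℝ with d₁² + 4c₂ ≠ 0, and define f(t) := (−d₀d₁ − 2c₁ − 2c₂d₀t + c₁d₁t)/(d₁² + 4c₂) + 𝒞·√(−1 + d₁t + c₂t²). Then at every t > 0 with −1 + d₁t + c₂t² > 0, f is differentiable and satisfies the ODE −2 f'(t)·(1 − d₁t − c₂t²) = d₀ + c₁t + (d₁ + 2c₂t)·f(t). -/
/-- Theorem 2 (solution formula): with `d₁² + 4c₂ ≠ 0`, the function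
`f(t) = (−d₀d₁ − 2c₁ − 2c₂d₀t + c₁d₁t)/(d₁² + 4c₂) + 𝒞·√(−1 + d₁t + c₂t²)`
is differentiable at every `t > 0` where `−1 + d₁t + c₂t² > 0` and satisfies
`−2f'(t)·(1 − d₁t − c₂t²) = d₀ + c₁t + (d₁ + 2c₂t)·f(t)` there. -/
theorem theorem2_solution_formula (d0 d1 c0 c1 c2 𝒞 : ℝ) (h : d1 ^ 2 + 4 * c2 ≠ 0) :
    ∀ t : ℝ, 0 < t → 0 < -1 + d1 * t + c2 * t ^ 2 →
      DifferentiableAt ℝ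
        (fun s : ℝ =>
          (-d0 * d1 - 2 * c1 - 2 * c2 * d0 * s + c1 * d1 * s) / (d1 ^ 2 + 4 * c2)
            + 𝒞 * Real.sqrt (-1 + d1 * s + c2 * s ^ 2)) t ∧
      -2 * deriv
          (fun s : ℝ =>
            (-d0 * d1 - 2 * c1 - 2 * c2 * d0 * s + c1 * d1 * s) / (d1 ^ 2 + 4 * c2)
              + 𝒞 * Real.sqrt (-1 + d1 * s + c2 * s ^ 2)) t *
          (1 - d1 * t - c2 * t ^ 2)
        = d0 + c1 * t + (d1 + 2 * c2 * t) *
            ((-d0 * d1 - 2 * c1 - 2 * c2 * d0 * t + c1 * d1 * t) / (d1 ^ 2 + 4 * c2)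
              + 𝒞 * Real.sqrt (-1 + d1 * t + c2 * t ^ 2)) := by
  intro t _ hQ
  have hq : HasDerivAt (fun s : ℝ => -1 + d1 * s + c2 * s ^ 2) (d1 + 2 * c2 * t) t := by
    have h1 := (((hasDerivAt_id' t).const_mul d1).const_add (-1)).add
      (((hasDerivAt_id' t).pow 2).const_mul c2)
    refine h1.congr_deriv ?_
    simp
    ring
  have hp : HasDerivAt (fun s : ℝ =>
      (-d0 * d1 - 2 * c1 - 2 * c2 * d0 * s + c1 * d1 * s) / (d1 ^ 2 + 4 * c2))
      ((c1 * d1 - 2 * c2 * d0) / (d1 ^ 2 + 4 * c2)) t := by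
    have h1 := ((((hasDerivAt_id' t).const_mul (2 * c2 * d0)).const_sub
      (-d0 * d1 - 2 * c1)).add ((hasDerivAt_id' t).const_mul (c1 * d1))).div_const
      (d1 ^ 2 + 4 * c2)
    refine h1.congr_deriv ?_
    ring
  have hf := hp.add ((hq.sqrt hQ.ne').const_mul 𝒞)
  refine ⟨hf.differentiableAt, ?_⟩
  have hd := hf.deriv
  simp only [Pi.add_def] at hd
  rw [hd]
  have hs : 0 < Real.sqrt (-1 + d1 * t + c2 * t ^ 2) := Real.sqrt_pos.mpr hQ
  have hsq := Real.sq_sqrt hQ.le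
  generalize Real.sqrt (-1 + d1 * t + c2 * t ^ 2) = r at hs hsq
  have e : 1 - d1 * t - c2 * t ^ 2 = -r ^ 2 := by rw [hsq]; ring
  have e1 : (d1 + 2 * c2 * t) / (2 * r) * r ^ 2 * 2 = (d1 + 2 * c2 * t) * r := by
    field_simp
  have e2 : 2 * ((c1 * d1 - 2 * c2 * d0) / (d1 ^ 2 + 4 * c2)) * (-1 + d1 * t + c2 * t ^ 2)
      = d0 + c1 * t + (d1 + 2 * c2 * t) *
        ((-d0 * d1 - 2 * c1 - 2 * c2 * d0 * t + c1 * d1 * t) / (d1 ^ 2 + 4 * c2)) := by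
    have hD := mul_inv_cancel₀ h
    simp only [div_eq_mul_inv]
    generalize (d1 ^ 2 + 4 * c2)⁻¹ = w at hD
    linear_combination (d0 + c1 * t) * hD
  rw [← hsq] at e2
  rw [e]
  linear_combination e2 + 𝒞 * e1
end

section
/- (General boundary equation in the proof of Theorem 3.) Let d₀, c₀, c₁, b₀, b₁, b₂ ∈ ℝ and U = (0,∞) × ℝ. Suppose ν : ℝ × ℝ → ℝ is smooth (C^∞) on U, satisfies the heat equation ∂_t ν = (1/2)·∂²_{xx} ν on U, and satisfies ∂³_x ν = (d₀ + c₁t + b₂t²)·∂²_x ν + (c₀ + c₁x + b₁t + 2b₂tx)·∂_x ν + (b₀ + b₁x + b₂x² + b₂t)·ν for all (t,x) ∈ U. Let f : (0,∞) → ℝ be twice differentiable with ν(t, f(t)) = 0 and ∂_x ν(t, f(t)) ≠ 0 for all t > 0. Then for all t > 0, writing F = f(t): −4f''(t) + 8(f'(t))³ + 8(f'(t))²·(d₀ + c₁t + b₂t²) − 4f'(t)·(c₀ + c₁F + b₁t + 2b₂tF) = −2f'(t)·(d₀ + c₁t + b₂t²)² + (c₀ + c₁F + b₁t + 2b₂tF)·(d₀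 + c₁t + b₂t²) − 2f'(t)·(c₀ + c₁F + b₁t + 2b₂tF) + (c₁ + b₀ + b₁F + b₂F² + 3b₂t). -/
/-- Smoothness on the open half plane. -/
def SmoothU (g : ℝ → ℝ → ℝ) : Prop :=
  ContDiffOn ℝ (⊤ : ℕ∞) (fun p : ℝ × ℝ => g p.1 p.2) (Set.Ioi (0 : ℝ) ×ˢ Set.univ)

lemma two_le_infty : (1 + 1 : WithTop ℕ∞) ≤ ((⊤ : ℕ∞) : WithTop ℕ∞) :=
  WithTop.coe_le_coe.2 (le_top : (1 + 1 : ℕ∞) ≤ ⊤)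

lemma isOpen_U : IsOpen (Set.Ioi (0 : ℝ) ×ˢ (Set.univ : Set ℝ)) := isOpen_Ioi.prod isOpen_univ

lemma SmoothU.contDiffAt {g : ℝ → ℝ → ℝ} (h : SmoothU g) {t : ℝ} (ht : 0 < t) (x : ℝ) :
    ContDiffAt ℝ (⊤ : ℕ∞) (fun p : ℝ × ℝ => g p.1 p.2) (t, x) :=
  ContDiffOn.contDiffAt h (isOpen_U.mem_nhds ⟨ht, trivial⟩)

lemma SmoothU.hasFDerivAt {g : ℝ → ℝ → ℝ} (h : SmoothU g) {t : ℝ} (ht : 0 < t) (x : ℝ) :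
    HasFDerivAt (fun p : ℝ × ℝ => g p.1 p.2)
      (fderiv ℝ (fun p : ℝ × ℝ => g p.1 p.2) (t, x)) (t, x) :=
  ((h.contDiffAt ht x).differentiableAt (by simp)).hasFDerivAt

lemma SmoothU.hasDerivAt_comp {g : ℝ → ℝ → ℝ} (h : SmoothU g) {u v : ℝ → ℝ} {s u' v' : ℝ}
    (hs : 0 < u s) (hu : HasDerivAt u u' s) (hv : HasDerivAt v v' s) :
    HasDerivAt (fun r => g (u r) (v r))
      (fderiv ℝ (fun p : ℝ × ℝ => g p.1 p.2) (u s, v s) (u', v')) s := by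
  have h1 := h.hasFDerivAt hs (v s)
  exact HasFDerivAt.comp_hasDerivAt (f := fun r => (u r, v r)) s h1 (hu.prodMk hv)

lemma SmoothU.hasDerivAt_x {g : ℝ → ℝ → ℝ} (h : SmoothU g) {t : ℝ} (ht : 0 < t) (x : ℝ) :
    HasDerivAt (fun y => g t y)
      (fderiv ℝ (fun p : ℝ × ℝ => g p.1 p.2) (t, x) (0, 1)) x :=
  h.hasDerivAt_comp (u := fun _ => t) (v := fun y => y) ht (hasDerivAt_const x t) (hasDerivAt_id' x)

lemma SmoothU.hasDerivAt_t {g : ℝ → ℝ → ℝ} (h : SmoothU g) {t : ℝ} (ht : 0 < t) (x : ℝ) :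
    HasDerivAt (fun s => g s x)
      (fderiv ℝ (fun p : ℝ × ℝ => g p.1 p.2) (t, x) (1, 0)) t :=
  h.hasDerivAt_comp (u := fun s => s) (v := fun _ => x) ht (hasDerivAt_id' t) (hasDerivAt_const t x)

lemma SmoothU.chain {g : ℝ → ℝ → ℝ} (h : SmoothU g) {t : ℝ} (ht : 0 < t) {f : ℝ → ℝ} {f' : ℝ}
    (hf : HasDerivAt f f' t) :
    HasDerivAt (fun s => g s (f s))
      (deriv (fun s => g s (f t)) t + f' * deriv (fun y => g t y) (f t)) t := by
  have := h.hasDerivAt_comp (u := fun s => s) ht (hasDerivAt_id' t) hf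
  rw [(h.hasDerivAt_t ht (f t)).deriv, (h.hasDerivAt_x ht (f t)).deriv]
  convert this using 1
  have e : ((1 : ℝ), f') = (1, 0) + f' • ((0 : ℝ), (1 : ℝ)) := by simp
  rw [e, map_add, map_smul, smul_eq_mul]

lemma SmoothU.fderiv_apply {g : ℝ → ℝ → ℝ} (h : SmoothU g) (w : ℝ × ℝ) :
    SmoothU (fun t x => fderiv ℝ (fun p : ℝ × ℝ => g p.1 p.2) (t, x) w) := by
  have h1 : ContDiffOn ℝ (⊤ : ℕ∞) (fderiv ℝ (fun p : ℝ × ℝ => g p.1 p.2))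
      (Set.Ioi (0 : ℝ) ×ˢ Set.univ) :=
    ContDiffOn.fderiv_of_isOpen h isOpen_U (by simp)
  exact h1.clm_apply contDiffOn_const

lemma SmoothU.dx {g : ℝ → ℝ → ℝ} (h : SmoothU g) : SmoothU (fun t x => deriv (fun y => g t y) x) :=
  ContDiffOn.congr (h.fderiv_apply (0, 1)) fun p hp => (h.hasDerivAt_x hp.1 p.2).deriv

lemma SmoothU.swap {g : ℝ → ℝ → ℝ} (h : SmoothU g) {t : ℝ} (ht : 0 < t) (x : ℝ) :
    deriv (fun s => deriv (fun y => g s y) x) t = deriv (fun y => deriv (fun s => g s y) t) x := by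
  have e1 : (fun s => deriv (fun y => g s y) x) =ᶠ[nhds t]
      fun s => fderiv ℝ (fun p : ℝ × ℝ => g p.1 p.2) (s, x) (0, 1) := by
    filter_upwards [lt_mem_nhds ht] with s hs
    exact (h.hasDerivAt_x hs x).deriv
  have e2 : (fun y => deriv (fun s => g s y) t) =
      fun y => fderiv ℝ (fun p : ℝ × ℝ => g p.1 p.2) (t, y) (1, 0) := by
    funext y
    exact (h.hasDerivAt_t ht y).deriv
  rw [e1.deriv_eq, e2, ((h.fderiv_apply (0, 1)).hasDerivAt_t ht x).deriv,
    ((h.fderiv_apply (1, 0)).hasDerivAt_x ht x).deriv]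
  have hd : DifferentiableAt ℝ (fderiv ℝ (fun p : ℝ × ℝ => g p.1 p.2)) (t, x) :=
    ((h.contDiffAt ht x).fderiv_right (m := 1) (one_add_one_eq_two (R := WithTop ℕ∞) ▸ two_le_infty)).differentiableAt
      (by simp)
  have key : ∀ w z : ℝ × ℝ, fderiv ℝ (fun p : ℝ × ℝ =>
      fderiv ℝ (fun p : ℝ × ℝ => g p.1 p.2) (p.1, p.2) w) (t, x) z =
      fderiv ℝ (fderiv ℝ (fun p : ℝ × ℝ => g p.1 p.2)) (t, x) z w := by
    intro w z
    have := (hd.hasFDerivAt.clm_apply (hasFDerivAt_const w (t, x))).fderiv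
    simp only [Prod.mk.eta]
    rw [this]
    simp
  rw [key, key]
  exact (h.contDiffAt ht x).isSymmSndFDerivAt (by simpa using (one_add_one_eq_two (R := WithTop ℕ∞) ▸ two_le_infty)) _ _

/-- General boundary equation in the proof of Theorem 3: if `ν` is `C^∞` on
`U = (0,∞) × ℝ`, solves the heat equation on `U`, satisfies the third-order identity
`∂³_x ν = (d₀ + c₁t + b₂t²)·∂²_x ν + (c₀ + c₁x + b₁t + 2b₂tx)·∂_x ν
        + (b₀ + b₁x + b₂x² + b₂t)·ν` on `U`, and vanishes along a twice differentiable
boundary `f` with `∂_x ν(t,f(t)) ≠ 0`, then the stated second-order ODE for `f` holds. -/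
theorem general_boundary_equation (d0 c0 c1 b0 b1 b2 : ℝ) (ν : ℝ → ℝ → ℝ) (f : ℝ → ℝ)
    (hν : ContDiffOn ℝ (⊤ : ℕ∞) (fun p : ℝ × ℝ => ν p.1 p.2) (Set.Ioi (0 : ℝ) ×ˢ Set.univ))
    (hheat : ∀ t : ℝ, 0 < t → ∀ x : ℝ,
      deriv (fun s : ℝ => ν s x) t = (1 / 2) * iteratedDeriv 2 (fun y : ℝ => ν t y) x)
    (hid : ∀ t : ℝ, 0 < t → ∀ x : ℝ,
      iteratedDeriv 3 (fun y : ℝ => ν t y) x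
        = (d0 + c1 * t + b2 * t ^ 2) * iteratedDeriv 2 (fun y : ℝ => ν t y) x
          + (c0 + c1 * x + b1 * t + 2 * b2 * t * x) * deriv (fun y : ℝ => ν t y) x
          + (b0 + b1 * x + b2 * x ^ 2 + b2 * t) * ν t x)
    (hf : ∀ t : ℝ, 0 < t → DifferentiableAt ℝ f t)
    (hf' : ∀ t : ℝ, 0 < t → DifferentiableAt ℝ (deriv f) t)
    (hzero : ∀ t : ℝ, 0 < t → ν t (f t) = 0)
    (hne : ∀ t : ℝ, 0 < t → deriv (fun y : ℝ => ν t y) (f t) ≠ 0) :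
    ∀ t : ℝ, 0 < t →
      -4 * deriv (deriv f) t + 8 * (deriv f t) ^ 3
          + 8 * (deriv f t) ^ 2 * (d0 + c1 * t + b2 * t ^ 2)
          - 4 * deriv f t * (c0 + c1 * f t + b1 * t + 2 * b2 * t * f t)
        = -2 * deriv f t * (d0 + c1 * t + b2 * t ^ 2) ^ 2
          + (c0 + c1 * f t + b1 * t + 2 * b2 * t * f t) * (d0 + c1 * t + b2 * t ^ 2)
          - 2 * deriv f t * (c0 + c1 * f t + b1 * t + 2 * b2 * t * f t)
          + (c1 + b0 + b1 * f t + b2 * (f t) ^ 2 + 3 * b2 * t) := by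
  intro t ht
  have S0 : SmoothU ν := hν
  have S1 := S0.dx
  have S2 := S1.dx
  have i2 : ∀ s x, iteratedDeriv 2 (fun y : ℝ => ν s y) x
      = deriv (fun y => deriv (fun z => ν s z) y) x := by
    intro s x; rw [iteratedDeriv_succ, iteratedDeriv_one]
  have i3 : ∀ s x, iteratedDeriv 3 (fun y : ℝ => ν s y) x
      = deriv (fun y => deriv (fun z => deriv (fun w => ν s w) z) y) x := by
    intro s x; rw [iteratedDeriv_succ]; congr 1; funext y; exact i2 s y
  simp only [i2, i3] at hheat hid
  have S3 := S2.dx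
  set n1 : ℝ → ℝ → ℝ := fun s x => deriv (fun y => ν s y) x with hn1
  set n2 : ℝ → ℝ → ℝ := fun s x => deriv (fun y => n1 s y) x with hn2
  set n3 : ℝ → ℝ → ℝ := fun s x => deriv (fun y => n2 s y) x with hn3
  have hheat' : ∀ s : ℝ, 0 < s → ∀ x, deriv (fun r => ν r x) s = 1 / 2 * n2 s x := hheat
  have hid' : ∀ s : ℝ, 0 < s → ∀ x, n3 s x = (d0 + c1 * s + b2 * s ^ 2) * n2 s x
      + (c0 + c1 * x + b1 * s + 2 * b2 * s * x) * n1 s x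
      + (b0 + b1 * x + b2 * x ^ 2 + b2 * s) * ν s x := hid
  -- time derivatives of the spatial derivatives
  have t1 : ∀ s : ℝ, 0 < s → ∀ x, deriv (fun r => n1 r x) s = 1 / 2 * n3 s x := by
    intro s hs x
    have := S0.swap hs x
    simp only [hheat' s hs, deriv_const_mul_field] at this
    exact this
  have t2 : deriv (fun r => n2 r (f t)) t = 1 / 2 * deriv (fun y => n3 t y) (f t) := by
    have := S1.swap ht (f t)
    simp only [t1 t ht, deriv_const_mul_field] at this
    exact this
  -- first relation on the boundary
  have E1 : ∀ s : ℝ, 0 < s → n2 s (f s) + 2 * (deriv f s * n1 s (f s)) = 0 := by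
    intro s hs
    have h1 := S0.chain hs (hf s hs).hasDerivAt
    have h2 : (fun r => ν r (f r)) =ᶠ[nhds s] fun _ => (0 : ℝ) := by
      filter_upwards [lt_mem_nhds hs] with r hr using hzero r hr
    have h3 := h1.unique ((hasDerivAt_const s (0 : ℝ)).congr_of_eventuallyEq h2)
    rw [hheat' s hs] at h3
    change 1 / 2 * n2 s (f s) + deriv f s * n1 s (f s) = 0 at h3
    linarith
  -- second relation
  have E2 : 1 / 2 * deriv (fun y => n3 t y) (f t) + deriv f t * n3 t (f t)
      + 2 * (deriv (deriv f) t * n1 t (f t)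
        + deriv f t * (1 / 2 * n3 t (f t) + deriv f t * n2 t (f t))) = 0 := by
    have ha := S2.chain ht (hf t ht).hasDerivAt
    have hb := S1.chain ht (hf t ht).hasDerivAt
    have h1 := ha.add (((hf' t ht).hasDerivAt.mul hb).const_mul 2)
    have h2 : (fun r => n2 r (f r) + 2 * (deriv f r * n1 r (f r))) =ᶠ[nhds t]
        fun _ => (0 : ℝ) := by
      filter_upwards [lt_mem_nhds ht] with r hr using E1 r hr
    have h3 := h1.unique ((hasDerivAt_const t (0 : ℝ)).congr_of_eventuallyEq h2)
    have q1 := t1 t ht (f t)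
    change deriv (fun s => n2 s (f t)) t + deriv f t * n3 t (f t)
      + 2 * (deriv (deriv f) t * n1 t (f t) + deriv f t *
        (deriv (fun s => n1 s (f t)) t + deriv f t * n2 t (f t))) = 0 at h3
    rw [t2, q1] at h3
    exact h3
  -- fourth spatial derivative
  have E4 : deriv (fun y => n3 t y) (f t) = (d0 + c1 * t + b2 * t ^ 2) * n3 t (f t)
      + ((c1 + 2 * b2 * t) * n1 t (f t)
        + (c0 + c1 * f t + b1 * t + 2 * b2 * t * f t) * n2 t (f t))
      + ((b1 + 2 * b2 * f t) * ν t (f t)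
        + (b0 + b1 * f t + b2 * (f t) ^ 2 + b2 * t) * n1 t (f t)) := by
    have k0 : HasDerivAt (fun y => ν t y) (n1 t (f t)) (f t) :=
      (S0.hasDerivAt_x ht (f t)).differentiableAt.hasDerivAt
    have k1 : HasDerivAt (fun y => n1 t y) (n2 t (f t)) (f t) :=
      (S1.hasDerivAt_x ht (f t)).differentiableAt.hasDerivAt
    have k2 : HasDerivAt (fun y => n2 t y) (n3 t (f t)) (f t) :=
      (S2.hasDerivAt_x ht (f t)).differentiableAt.hasDerivAt
    have kB : HasDerivAt (fun y : ℝ => c0 + c1 * y + b1 * t + 2 * b2 * t * y)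
        (c1 + 2 * b2 * t) (f t) := by
      have hx := hasDerivAt_id' (f t)
      exact ((((hx.const_mul c1).const_add c0).add_const (b1 * t)).add
        (hx.const_mul (2 * b2 * t))).congr_deriv (by ring)
    have kC : HasDerivAt (fun y : ℝ => b0 + b1 * y + b2 * y ^ 2 + b2 * t)
        (b1 + 2 * b2 * f t) (f t) := by
      have hx := hasDerivAt_id' (f t)
      exact ((((hx.const_mul b1).const_add b0).add ((hx.pow 2).const_mul b2)).add_const
        (b2 * t)).congr_deriv (by norm_num; ring)
    have e : (fun y => n3 t y) = fun y => (d0 + c1 * t + b2 * t ^ 2) * n2 t y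
      + (c0 + c1 * y + b1 * t + 2 * b2 * t * y) * n1 t y
      + (b0 + b1 * y + b2 * y ^ 2 + b2 * t) * ν t y := funext (hid' t ht)
    rw [e]
    exact (((k2.const_mul _).add (kB.mul k1)).add (kC.mul k0)).deriv
  have E3 := hid' t ht (f t)
  have E1t : n2 t (f t) = -2 * deriv f t * n1 t (f t) := by linarith [E1 t ht]
  have hne' : n1 t (f t) ≠ 0 := hne t ht
  rw [hzero t ht] at E3 E4
  rw [E4, E3, E1t] at E2
  apply mul_left_cancel₀ hne'
  linear_combination (-2) * E2
end

section
/- (Theorem 3, uniqueness among cubic boundaries.) Let b₂, δ ∈ ℝ and suppose f(t) = δ·t³ satisfies −4f''(t) + 2f'(t)·[4(f'(t))² + 4b₂t²f'(t) − 2b₂t·f(t) + b₂²t⁴] − b₂·f(t)·[2b₂t³ + f(t)] − 3b₂t = 0 for all t > 0. Then δ = −b₂/8. -/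
/-- Theorem 3 (uniqueness among cubic boundaries): if `f(t) = δ·t³` satisfies
`−4f'' + 2f'·[4(f')² + 4b₂t²f' − 2b₂t·f + b₂²t⁴] − b₂·f·[2b₂t³ + f] − 3b₂t = 0`
for all `t > 0`, then `δ = −b₂/8`. -/
theorem cubic_boundary_uniqueness (b2 δ : ℝ)
    (h : ∀ t : ℝ, 0 < t →
      -4 * deriv (deriv (fun s : ℝ => δ * s ^ 3)) t
          + 2 * deriv (fun s : ℝ => δ * s ^ 3) t *
            (4 * (deriv (fun s : ℝ => δ * s ^ 3) t) ^ 2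
              + 4 * b2 * t ^ 2 * deriv (fun s : ℝ => δ * s ^ 3) t
              - 2 * b2 * t * (δ * t ^ 3) + b2 ^ 2 * t ^ 4)
          - b2 * (δ * t ^ 3) * (2 * b2 * t ^ 3 + δ * t ^ 3) - 3 * b2 * t = 0) :
    δ = -b2 / 8 := by
  have h1 : deriv (fun s : ℝ => δ * s ^ 3) = fun s => 3 * δ * s ^ 2 := by
    funext s
    have := ((hasDerivAt_pow 3 s).const_mul δ).deriv
    rw [this]
    norm_num
    ring
  have h2 : deriv (fun s : ℝ => 3 * δ * s ^ 2) = fun s => 6 * δ * s := by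
    funext s
    have := ((hasDerivAt_pow 2 s).const_mul (3 * δ)).deriv
    rw [this]
    norm_num
    ring
  rw [h1, h2] at h
  have e1 := h 1 (by norm_num)
  have e2 := h 2 (by norm_num)
  ring_nf at e1 e2
  linarith
end

section
/- (Example 3, power-series solution of φ''' = b₂x²φ.) Let b₂ ∈ ℝ and define a sequence (a_k) by a₀ = 1 and a_{k+1} = b₂·a_k / ((5k+4)(5k+5)(5k+6)) for k ≥ 0. Then for every x ∈ ℝ the series φ(x) := Σ_{k=0}^∞ a_k·x^{5k+1} converges absolutely, the resulting function φ : ℝ → ℝ is infinitely differentiable, satisfies φ(0) = 0 and φ'(0) = 1, and satisfies φ'''(x) = b₂·x²·φ(x) for all x ∈ ℝ. -/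
/-- Coefficient sequences with infinite radius of convergence. -/
def EntireCoeff (c : ℕ → ℝ) : Prop := ∀ R : ℝ, 0 ≤ R → Summable (fun k => |c k| * R ^ k)

theorem EntireCoeff.mul_exp {c : ℕ → ℝ} (h : EntireCoeff c) {e : ℕ → ℕ}
    (he : ∀ k, e k ≤ 5 * k + 1) : EntireCoeff (fun k => c k * (e k : ℝ)) := by
  intro R hR
  refine Summable.of_nonneg_of_le (fun k => by positivity) (fun k => ?_)
    ((h (2 * R) (by positivity)).mul_left 6)
  have h1 : e k ≤ 6 * 2 ^ k := by
    have := he k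
    have h2 : k < 2 ^ k := Nat.lt_two_pow_self
    omega
  have h2 : (e k : ℝ) ≤ 6 * 2 ^ k := by exact_mod_cast h1
  rw [abs_mul, Nat.abs_cast, mul_pow]
  calc |c k| * (e k : ℝ) * R ^ k ≤ |c k| * (6 * 2 ^ k) * R ^ k := by gcongr
    _ = _ := by ring

theorem EntireCoeff.summable_bound {c : ℕ → ℝ} (h : EntireCoeff c) {e : ℕ → ℕ}
    (he : ∀ k, e k ≤ 5 * k + 1) (R : ℝ) (hR : 0 ≤ R) :
    Summable (fun k => |c k| * R ^ (e k)) := by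
  refine Summable.of_nonneg_of_le (fun k => by positivity) (fun k => ?_)
    ((h ((1 + R) ^ 5) (by positivity)).mul_left (1 + R))
  calc |c k| * R ^ (e k) ≤ |c k| * (1 + R) ^ (e k) := by gcongr; linarith
    _ ≤ |c k| * (1 + R) ^ (5 * k + 1) := by
        gcongr
        · linarith
        · exact he k
    _ = _ := by rw [pow_succ, pow_mul]; ring

theorem EntireCoeff.hasDerivAt {c : ℕ → ℝ} (h : EntireCoeff c) {e : ℕ → ℕ}
    (he : ∀ k, e k ≤ 5 * k + 1) (x : ℝ) :
    HasDerivAt (fun y : ℝ => ∑' k, c k * y ^ (e k))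
      (∑' k, (c k * (e k : ℝ)) * x ^ (e k - 1)) x := by
  have he' : ∀ k, e k - 1 ≤ 5 * k + 1 := fun k => (Nat.sub_le _ _).trans (he k)
  have hb := (h.mul_exp he).summable_bound he' (|x| + 1) (by positivity)
  have hx : x ∈ Metric.ball (0 : ℝ) (|x| + 1) := by simp
  refine hasDerivAt_tsum_of_isPreconnected (t := Metric.ball (0 : ℝ) (|x| + 1))
    (g := fun k y => c k * y ^ (e k)) (g' := fun k y => (c k * (e k : ℝ)) * y ^ (e k - 1))
    (y₀ := x) hb Metric.isOpen_ball
    (convex_ball _ _).isPreconnected (fun k y _ => ?_) (fun k y hy => ?_) hx ?_ hx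
  · simpa [mul_assoc] using (hasDerivAt_pow (e k) y).const_mul (c k)
  · rw [Real.norm_eq_abs, abs_mul, abs_pow]
    have : |y| ≤ |x| + 1 := by
      have := hy
      rw [mem_ball_zero_iff, Real.norm_eq_abs] at this
      exact this.le
    gcongr
  · refine Summable.of_abs ?_
    simpa [abs_mul, abs_pow] using h.summable_bound he |x| (abs_nonneg x)

theorem EntireCoeff.contDiff (n : ℕ) : ∀ {c : ℕ → ℝ} (_ : EntireCoeff c) {e : ℕ → ℕ}
    (_ : ∀ k, e k ≤ 5 * k + 1), ContDiff ℝ n (fun y : ℝ => ∑' k, c k * y ^ (e k)) := by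
  induction n with
  | zero =>
    intro c h e he
    exact contDiff_zero.2 (continuous_iff_continuousAt.2 fun x => (h.hasDerivAt he x).continuousAt)
  | succ n ih =>
    intro c h e he
    have hd : deriv (fun y : ℝ => ∑' k, c k * y ^ (e k)) =
        fun x => ∑' k, (c k * (e k : ℝ)) * x ^ (e k - 1) :=
      funext fun x => (h.hasDerivAt he x).deriv
    have := ih (h.mul_exp he) (e := fun k => e k - 1) (fun k => (Nat.sub_le _ _).trans (he k))
    push_cast
    refine contDiff_succ_iff_deriv.2 ⟨fun x => (h.hasDerivAt he x).differentiableAt, by simp, ?_⟩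
    rw [hd]
    exact this

theorem entireCoeff_rec (b2 : ℝ) (a : ℕ → ℝ) (ha0 : a 0 = 1)
    (haRec : ∀ k : ℕ, a (k + 1)
      = b2 * a k / ((5 * k + 4) * (5 * k + 5) * (5 * k + 6) : ℝ)) : EntireCoeff a := by
  have hb : ∀ k, |a k| ≤ |b2| ^ k / (k.factorial : ℝ) := by
    intro k
    induction k with
    | zero => simp [ha0]
    | succ k ih =>
      have hk : (0 : ℝ) ≤ k := k.cast_nonneg
      rw [haRec, abs_div, abs_mul, Nat.factorial_succ, pow_succ,
        abs_of_pos (by positivity : (0 : ℝ) < (5 * k + 4) * (5 * k + 5) * (5 * k + 6))]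
      push_cast
      calc |b2| * |a k| / ((5 * k + 4) * (5 * k + 5) * (5 * k + 6) : ℝ)
          ≤ |b2| * (|b2| ^ k / (k.factorial : ℝ)) / ((k : ℝ) + 1) := by
            gcongr
            have : (0 : ℝ) ≤ k ^ 2 := by positivity
            have : (0 : ℝ) ≤ k ^ 3 := by positivity
            nlinarith
        _ = _ := by
            field_simp
  intro R hR
  refine Summable.of_nonneg_of_le (fun k => by positivity) (fun k => ?_)
    (Real.summable_pow_div_factorial (|b2| * R))
  calc |a k| * R ^ k ≤ |b2| ^ k / (k.factorial : ℝ) * R ^ k := by gcongr; exact hb k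
    _ = _ := by rw [mul_pow]; ring


/-- Example 3 (power-series solution of `φ''' = b₂x²φ`): with `a₀ = 1` and
`a_{k+1} = b₂·a_k/((5k+4)(5k+5)(5k+6))`, the series `φ(x) = Σ_k a_k·x^{5k+1}` converges
absolutely for every `x`, defines a `C^∞` function with `φ(0) = 0`, `φ'(0) = 1`, and
`φ'''(x) = b₂·x²·φ(x)` for all `x`. -/
theorem power_series_solution (b2 : ℝ) (a : ℕ → ℝ) (ha0 : a 0 = 1)
    (haRec : ∀ k : ℕ, a (k + 1)
      = b2 * a k / ((5 * k + 4) * (5 * k + 5) * (5 * k + 6) : ℝ)) :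
    (∀ x : ℝ, Summable (fun k : ℕ => |a k * x ^ (5 * k + 1)|)) ∧
    ContDiff ℝ (⊤ : ℕ∞) (fun x : ℝ => ∑' k : ℕ, a k * x ^ (5 * k + 1)) ∧
    (∑' k : ℕ, a k * (0 : ℝ) ^ (5 * k + 1)) = 0 ∧
    deriv (fun x : ℝ => ∑' k : ℕ, a k * x ^ (5 * k + 1)) 0 = 1 ∧
    (∀ x : ℝ, iteratedDeriv 3 (fun y : ℝ => ∑' k : ℕ, a k * y ^ (5 * k + 1)) x
      = b2 * x ^ 2 * ∑' k : ℕ, a k * x ^ (5 * k + 1)) := by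
  have h0 : EntireCoeff a := entireCoeff_rec b2 a ha0 haRec
  have e0 : ∀ k : ℕ, 5 * k + 1 ≤ 5 * k + 1 := fun k => le_rfl
  have e1 : ∀ k : ℕ, 5 * k + 1 - 1 ≤ 5 * k + 1 := fun k => by omega
  have e2 : ∀ k : ℕ, 5 * k + 1 - 1 - 1 ≤ 5 * k + 1 := fun k => by omega
  have h1 := h0.mul_exp e0
  have h2 := h1.mul_exp e1
  have d0 := funext fun x => (h0.hasDerivAt e0 x).deriv
  have d1 := funext fun x => (h1.hasDerivAt e1 x).deriv
  have d2 := funext fun x => (h2.hasDerivAt e2 x).deriv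
  have hs : ∀ x : ℝ, Summable (fun k : ℕ => |a k * x ^ (5 * k + 1)|) := fun x => by
    simpa only [abs_mul, abs_pow] using h0.summable_bound e0 |x| (abs_nonneg x)
  refine ⟨hs, ?_, by simp, ?_, fun x => ?_⟩
  · exact contDiff_infty.2 fun n => EntireCoeff.contDiff n h0 e0
  · rw [d0]
    beta_reduce
    rw [tsum_eq_single 0]
    · simp [ha0]
    · intro k hk
      simp [hk]
  · rw [iteratedDeriv_succ, iteratedDeriv_succ, iteratedDeriv_one, d0, d1, d2]
    have hsum := ((h2.mul_exp e2).summable_bound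
      (e := fun k => 5 * k + 1 - 1 - 1 - 1) (fun k => by omega) |x| (abs_nonneg x))
    have hsum' : Summable (fun k : ℕ => a k * ((5 * k + 1 : ℕ) : ℝ) * ((5 * k + 1 - 1 : ℕ) : ℝ)
        * ((5 * k + 1 - 1 - 1 : ℕ) : ℝ) * x ^ (5 * k + 1 - 1 - 1 - 1)) := by
      refine Summable.of_abs ?_
      simpa only [abs_mul, abs_pow] using hsum
    beta_reduce
    rw [hsum'.tsum_eq_zero_add, ← tsum_mul_left]
    simp only [mul_zero, zero_add, Nat.sub_self, Nat.cast_zero, zero_mul]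
    refine tsum_congr fun k => ?_
    have i1 : 5 * (k + 1) + 1 = 5 * k + 6 := by ring
    have i2 : 5 * k + 6 - 1 = 5 * k + 5 := by omega
    have i3 : 5 * k + 5 - 1 = 5 * k + 4 := by omega
    have i4 : 5 * k + 4 - 1 = 5 * k + 3 := by omega
    rw [i1, i2, i3, i4, haRec]
    push_cast
    have hk : (0 : ℝ) ≤ k := k.cast_nonneg
    have p1 : (5 * k + 4 : ℝ) ≠ 0 := by positivity
    have p2 : (5 * k + 5 : ℝ) ≠ 0 := by positivity
    have p3 : (5 * k + 6 : ℝ) ≠ 0 := by positivity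
    field_simp
    ring
end

section
/- (Introduction, quadratic boundary.) Let A : ℝ → ℝ be twice differentiable and satisfy the Airy equation A''(x) = x·A(x) for all x ∈ ℝ, and let ξ ∈ ℝ satisfy A(ξ) = 0. Define ν(t,x) := exp(t³/12 + t·x/2)·A(x + t²/4). Then ν satisfies the heat equation ∂_t ν(t,x) = (1/2)·∂²_{xx} ν(t,x) for all (t,x) ∈ ℝ × ℝ, and ν(t, ξ − t²/4) = 0 for all t ∈ ℝ. -/
/-- Introduction (quadratic boundary): if `A` is twice differentiable, satisfies the Airy
equation `A'' = x·A`, and `A(ξ) = 0`, then `ν(t,x) = exp(t³/12 + tx/2)·A(x + t²/4)`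
solves the heat equation `∂_t ν = (1/2)·∂²_{xx} ν` on `ℝ × ℝ` and vanishes on the
quadratic boundary `x = ξ − t²/4`. -/
theorem quadratic_boundary (A : ℝ → ℝ) (ξ : ℝ)
    (hA : Differentiable ℝ A) (hA' : Differentiable ℝ (deriv A))
    (hAiry : ∀ x : ℝ, deriv (deriv A) x = x * A x) (hξ : A ξ = 0) :
    (∀ t x : ℝ,
      deriv (fun s : ℝ => Real.exp (s ^ 3 / 12 + s * x / 2) * A (x + s ^ 2 / 4)) t
        = (1 / 2) * iteratedDeriv 2
            (fun y : ℝ => Real.exp (t ^ 3 / 12 + t * y / 2) * A (y + t ^ 2 / 4)) x) ∧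
    (∀ t : ℝ,
      Real.exp (t ^ 3 / 12 + t * (ξ - t ^ 2 / 4) / 2) * A ((ξ - t ^ 2 / 4) + t ^ 2 / 4)
        = 0) := by
  refine ⟨fun t x => ?_, fun t => ?_⟩
  · have hd : ∀ z, HasDerivAt A (deriv A z) z := fun z => (hA z).hasDerivAt
    have hd' : ∀ z, HasDerivAt (deriv A) (z * A z) z := fun z => by
      have h := (hA' z).hasDerivAt
      rwa [hAiry z] at h
    -- time derivative
    have ht1 : HasDerivAt (fun s : ℝ => s ^ 3 / 12 + s * x / 2) (t ^ 2 / 4 + x / 2) t := by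
      have h := ((hasDerivAt_pow 3 t).div_const 12).add
        (((hasDerivAt_id' t).mul_const x).div_const 2)
      refine h.congr_deriv ?_
      norm_num
      ring
    have ht2 : HasDerivAt (fun s : ℝ => x + s ^ 2 / 4) (t / 2) t := by
      have h := ((hasDerivAt_pow 2 t).div_const 4).const_add x
      refine h.congr_deriv ?_
      norm_num
      ring
    have ht := ht1.exp.mul ((hd (x + t ^ 2 / 4)).comp t ht2)
    -- space derivatives
    have hE : ∀ y, HasDerivAt (fun y : ℝ => Real.exp (t ^ 3 / 12 + t * y / 2))
        (Real.exp (t ^ 3 / 12 + t * y / 2) * (t / 2)) y := fun y => by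
      have h := (((hasDerivAt_id' y).const_mul t).div_const 2).const_add (t ^ 3 / 12)
      rw [mul_one] at h
      exact h.exp
    have hB : ∀ y, HasDerivAt (fun y : ℝ => A (y + t ^ 2 / 4)) (deriv A (y + t ^ 2 / 4)) y :=
      fun y => (hd _).comp_add_const y (t ^ 2 / 4)
    have hB' : ∀ y, HasDerivAt (fun y : ℝ => deriv A (y + t ^ 2 / 4))
        ((y + t ^ 2 / 4) * A (y + t ^ 2 / 4)) y :=
      fun y => (hd' _).comp_add_const y (t ^ 2 / 4)
    have h1 : deriv (fun y : ℝ => Real.exp (t ^ 3 / 12 + t * y / 2) * A (y + t ^ 2 / 4))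
        = fun y : ℝ => Real.exp (t ^ 3 / 12 + t * y / 2) * (t / 2) * A (y + t ^ 2 / 4)
          + Real.exp (t ^ 3 / 12 + t * y / 2) * deriv A (y + t ^ 2 / 4) :=
      funext fun y => ((hE y).mul (hB y)).deriv
    have h2 := ((((hE x).mul_const (t / 2)).mul (hB x)).add ((hE x).mul (hB' x))).deriv
    rw [iteratedDeriv_succ, iteratedDeriv_one, h1]
    refine ht.deriv.trans (Eq.trans ?_ (congrArg (fun z => 1 / 2 * z) h2).symm)
    simp only [Function.comp]
    ring
  · rw [sub_add_cancel, hξ, mul_zero]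
end
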